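/- For every ε > 0 there is a constant C = C(ε) such that for every squarefree positive integer q, every integer a coprime to q, and all real numbers M, N with 1 ≤ M ≤ q^(3/4), 1 ≤ N ≤ q^(3/4), M < q/2 and N < q/2, the number of pairs (m, n) of positive integers with M < m ≤ 2M, N < n ≤ 2N and m·n² ≡ a (mod q) is at most C · q^ε · (M·N²)^(11/36). -/

import Mathlib

open Finset

/-- The values `a, b, c, d` can be split into two pairs of equal elements. -/
def PairsUp {α : Type*} (a b c d : α) : Prop :=
  (a = c ∧ b = d) ∨ (a = d ∧ b = c) ∨ (a = b ∧ c = d)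

theorem exists_isolated_of_not_pairsUp {α : Type*} {a b c d : α} (h : ¬ PairsUp a b c d) :
    (a ≠ b ∧ a ≠ c ∧ a ≠ d) ∨ (b ≠ a ∧ b ≠ c ∧ b ≠ d) ∨
      (c ≠ a ∧ c ≠ b ∧ c ≠ d) ∨ (d ≠ a ∧ d ≠ b ∧ d ≠ c) := by
  unfold PairsUp at h
  by_cases hab : a = b <;> by_cases hac : a = c <;> by_cases had : a = d <;>
    by_cases hbc : b = c <;> by_cases hbd : b = d <;> by_cases hcd : c = d <;> grind

/-- The zeros of a form in four variables, evaluated at the products of three of the linear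
factors `X - a`, `X - b`, `X - c`, `X - d`, lie in a small set. -/
theorem exists_finset_roots {F : Type*} [Field F] {a b c d : F} {k : ℕ}
    (h : ¬ PairsUp a b c d) (G : F → F → F → F → F) (P : Polynomial F) (hP : P.natDegree ≤ k)
    (hG : ∀ x, P.eval x = G ((x - b) * (x - c) * (x - d)) ((x - a) * (x - c) * (x - d))
      ((x - a) * (x - b) * (x - d)) ((x - a) * (x - b) * (x - c)))
    (hG0 : ∀ x ≠ 0, G x 0 0 0 ≠ 0 ∧ G 0 x 0 0 ≠ 0 ∧ G 0 0 x 0 ≠ 0 ∧ G 0 0 0 x ≠ 0) :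
    ∃ R : Finset F, R.card ≤ k ∧ ∀ x, G ((x - b) * (x - c) * (x - d))
      ((x - a) * (x - c) * (x - d)) ((x - a) * (x - b) * (x - d))
      ((x - a) * (x - b) * (x - c)) = 0 → x ∈ R := by
  classical
  have hP0 : P ≠ 0 := by
    rintro rfl
    simp only [Polynomial.eval_zero] at hG
    rcases exists_isolated_of_not_pairsUp h with ⟨h1, h2, h3⟩ | ⟨h1, h2, h3⟩ | ⟨h1, h2, h3⟩ |
      ⟨h1, h2, h3⟩
    · have := hG a
      simp only [sub_self, zero_mul] at this
      exact (hG0 _ (mul_ne_zero (mul_ne_zero (sub_ne_zero.2 h1) (sub_ne_zero.2 h2))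
        (sub_ne_zero.2 h3))).1 this.symm
    · have := hG b
      simp only [sub_self, zero_mul, mul_zero] at this
      exact (hG0 _ (mul_ne_zero (mul_ne_zero (sub_ne_zero.2 h1) (sub_ne_zero.2 h2))
        (sub_ne_zero.2 h3))).2.1 this.symm
    · have := hG c
      simp only [sub_self, zero_mul, mul_zero] at this
      exact (hG0 _ (mul_ne_zero (mul_ne_zero (sub_ne_zero.2 h1) (sub_ne_zero.2 h2))
        (sub_ne_zero.2 h3))).2.2.1 this.symm
    · have := hG d
      simp only [sub_self, mul_zero] at this
      exact (hG0 _ (mul_ne_zero (mul_ne_zero (sub_ne_zero.2 h1) (sub_ne_zero.2 h2))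
        (sub_ne_zero.2 h3))).2.2.2 this.symm
  refine ⟨P.roots.toFinset, (Multiset.toFinset_card_le _).trans ((P.card_roots').trans hP), ?_⟩
  intro x hx
  rw [Multiset.mem_toFinset, Polynomial.mem_roots hP0, Polynomial.IsRoot, hG, hx]

open Polynomial in
theorem exists_finset_inverse_squares {F : Type*} [Field F] {a b c d : F}
    (h : ¬ PairsUp a b c d) :
    ∃ R : Finset F, R.card ≤ 12 ∧ ∀ r s m₁ m₂ m₃ m₄ : F, s ≠ 0 →
      m₁ * (r - a) ^ 2 = s → m₂ * (r - b) ^ 2 = s → m₃ * (r - c) ^ 2 = s →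
      m₄ * (r - d) ^ 2 = s → m₁ + m₂ = m₃ + m₄ → r ∈ R := by
  obtain ⟨R, hR, hmem⟩ := exists_finset_roots (k := 12) h
    (fun x y z w => x ^ 2 + y ^ 2 - z ^ 2 - w ^ 2)
    (((X - C b) * (X - C c) * (X - C d)) ^ 2 + ((X - C a) * (X - C c) * (X - C d)) ^ 2
      - ((X - C a) * (X - C b) * (X - C d)) ^ 2 - ((X - C a) * (X - C b) * (X - C c)) ^ 2)
    (le_trans (b := 6) (by compute_degree) (by norm_num)) (by intro x; simp)
    (by intro x hx; simp [hx])
  refine ⟨R, hR, fun r s m₁ m₂ m₃ m₄ hs h1 h2 h3 h4 hm => hmem r ?_⟩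
  have key : s * (((r - b) * (r - c) * (r - d)) ^ 2 + ((r - a) * (r - c) * (r - d)) ^ 2
      - ((r - a) * (r - b) * (r - d)) ^ 2 - ((r - a) * (r - b) * (r - c)) ^ 2) = 0 := by
    linear_combination
      (-((r - b) * (r - c) * (r - d)) ^ 2) * h1 - ((r - a) * (r - c) * (r - d)) ^ 2 * h2
      + ((r - a) * (r - b) * (r - d)) ^ 2 * h3 + ((r - a) * (r - b) * (r - c)) ^ 2 * h4
      + ((r - a) * (r - b) * (r - c) * (r - d)) ^ 2 * hm
  exact (mul_eq_zero.1 key).resolve_left hs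

open Polynomial in
theorem exists_finset_inverse_square_roots {F : Type*} [Field F] {a b c d : F}
    (h : ¬ PairsUp a b c d) :
    ∃ R : Finset F, R.card ≤ 12 ∧ ∀ r s n₁ n₂ n₃ n₄ : F, s ≠ 0 →
      n₁ ^ 2 * (r - a) = s → n₂ ^ 2 * (r - b) = s → n₃ ^ 2 * (r - c) = s →
      n₄ ^ 2 * (r - d) = s → n₁ + n₂ = n₃ + n₄ → r ∈ R := by
  obtain ⟨R, hR, hmem⟩ := exists_finset_roots (k := 12) h
    (fun x y z w => ((x + y - z - w) ^ 2 - 4 * (x * y) - 4 * (z * w)) ^ 2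
      - 64 * (x * y * (z * w)))
    ((((X - C b) * (X - C c) * (X - C d) + (X - C a) * (X - C c) * (X - C d)
      - (X - C a) * (X - C b) * (X - C d) - (X - C a) * (X - C b) * (X - C c)) ^ 2
      - C 4 * (((X - C b) * (X - C c) * (X - C d)) * ((X - C a) * (X - C c) * (X - C d)))
      - C 4 * (((X - C a) * (X - C b) * (X - C d)) * ((X - C a) * (X - C b) * (X - C c)))) ^ 2
      - C 64 * (((X - C b) * (X - C c) * (X - C d)) * ((X - C a) * (X - C c) * (X - C d)) *
        (((X - C a) * (X - C b) * (X - C d)) * ((X - C a) * (X - C b) * (X - C c)))))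
    (by compute_degree) (by intro x; simp) (by intro x hx; simp [hx])
  refine ⟨R, hR, fun r s n₁ n₂ n₃ n₄ hs h1 h2 h3 h4 hn => hmem r ?_⟩
  have form : ((n₁ ^ 2 + n₂ ^ 2 - n₃ ^ 2 - n₄ ^ 2) ^ 2 - 4 * (n₁ ^ 2 * n₂ ^ 2)
      - 4 * (n₃ ^ 2 * n₄ ^ 2)) ^ 2 - 64 * (n₁ ^ 2 * n₂ ^ 2 * (n₃ ^ 2 * n₄ ^ 2)) = 0 := by
    obtain rfl : n₄ = n₁ + n₂ - n₃ := by linear_combination -hn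
    ring
  have e1 : s * ((r - b) * (r - c) * (r - d)) =
      n₁ ^ 2 * ((r - a) * (r - b) * (r - c) * (r - d)) := by rw [← h1]; ring
  have e2 : s * ((r - a) * (r - c) * (r - d)) =
      n₂ ^ 2 * ((r - a) * (r - b) * (r - c) * (r - d)) := by rw [← h2]; ring
  have e3 : s * ((r - a) * (r - b) * (r - d)) =
      n₃ ^ 2 * ((r - a) * (r - b) * (r - c) * (r - d)) := by rw [← h3]; ring
  have e4 : s * ((r - a) * (r - b) * (r - c)) =
      n₄ ^ 2 * ((r - a) * (r - b) * (r - c) * (r - d)) := by rw [← h4]; ring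
  generalize (r - b) * (r - c) * (r - d) = x at *
  generalize (r - a) * (r - c) * (r - d) = y at *
  generalize (r - a) * (r - b) * (r - d) = z at *
  generalize (r - a) * (r - b) * (r - c) = w at *
  generalize w * (r - d) = t at *
  have key : s ^ 4 * (((x + y - z - w) ^ 2 - 4 * (x * y) - 4 * (z * w)) ^ 2
      - 64 * (x * y * (z * w))) = 0 := by
    calc _ = ((s * x + s * y - s * z - s * w) ^ 2 - 4 * (s * x * (s * y))
          - 4 * (s * z * (s * w))) ^ 2 - 64 * (s * x * (s * y) * (s * z * (s * w))) := by ring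
      _ = t ^ 4 * (((n₁ ^ 2 + n₂ ^ 2 - n₃ ^ 2 - n₄ ^ 2) ^ 2 - 4 * (n₁ ^ 2 * n₂ ^ 2)
      - 4 * (n₃ ^ 2 * n₄ ^ 2)) ^ 2 - 64 * (n₁ ^ 2 * n₂ ^ 2 * (n₃ ^ 2 * n₄ ^ 2))) := by
          rw [e1, e2, e3, e4]; ring
      _ = 0 := by rw [form, mul_zero]
  exact (mul_eq_zero.1 key).resolve_left (pow_ne_zero _ hs)

theorem Finset.card_le_prod_of_injOn {α ι : Type*} {β : ι → Type*} [Fintype ι] [DecidableEq ι]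
    [∀ i, DecidableEq (β i)] (S : Finset α) (φ : ∀ i, α → β i) (c : ι → ℕ)
    (hinj : ∀ x ∈ S, ∀ y ∈ S, (∀ i, φ i x = φ i y) → x = y)
    (hc : ∀ i, (S.image (φ i)).card ≤ c i) : S.card ≤ ∏ i, c i := by
  calc S.card ≤ (Fintype.piFinset fun i => S.image (φ i)).card := by
        refine Finset.card_le_card_of_injOn (fun x i => φ i x) ?_ ?_
        · intro x hx
          simp only [Finset.mem_coe, Fintype.mem_piFinset]
          exact fun i => Finset.mem_image_of_mem _ hx
        · intro x hx y hy h
          exact hinj x hx y hy fun i => congrFun h i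
    _ = ∏ i, (S.image (φ i)).card := Fintype.card_piFinset _
    _ ≤ ∏ i, c i := Finset.prod_le_prod' fun i _ => hc i

theorem Squarefree.intCast_dvd_of_forall_primeFactors {q : ℕ} (hq : Squarefree q) {z : ℤ}
    (h : ∀ p ∈ q.primeFactors, (p : ℤ) ∣ z) : (q : ℤ) ∣ z := by
  rw [Int.natCast_dvd, ← Nat.prod_primeFactors_of_squarefree hq]
  exact Finset.prod_primes_dvd _ (fun p hp => (Nat.prime_of_mem_primeFactors hp).prime)
    fun p hp => Int.natCast_dvd.1 (h p hp)

theorem Finset.card_sq_le_card_mul_card_eq {α β : Type*} [DecidableEq β] (S : Finset α)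
    (T : Finset β) (f : α → β) (hf : ∀ x ∈ S, f x ∈ T) :
    S.card ^ 2 ≤ T.card * ((S ×ˢ S).filter fun z => f z.1 = f z.2).card := by
  have h1 : S.card = ∑ t ∈ T, (S.filter fun x => f x = t).card :=
    Finset.card_eq_sum_card_fiberwise hf
  have h2 : ((S ×ˢ S).filter fun z => f z.1 = f z.2).card
      = ∑ t ∈ T, (S.filter fun x => f x = t).card ^ 2 := by
    rw [Finset.card_eq_sum_card_fiberwise (f := fun z => f z.1) (t := T)]
    · refine Finset.sum_congr rfl fun t _ => ?_
      rw [sq, ← Finset.card_product]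
      congr 1
      ext ⟨x, y⟩
      simp only [Finset.mem_filter, Finset.mem_product]
      constructor
      · rintro ⟨⟨⟨hx, hy⟩, h⟩, ht⟩
        exact ⟨⟨hx, ht⟩, hy, h ▸ ht⟩
      · rintro ⟨⟨hx, ht⟩, hy, ht'⟩
        exact ⟨⟨⟨hx, hy⟩, ht.trans ht'.symm⟩, ht⟩
    · intro z hz
      simp only [Finset.coe_filter, Finset.mem_product, Set.mem_ofPred_eq] at hz
      exact hf _ hz.1.1
  rw [h2]
  nth_rewrite 1 [h1]
  exact sq_sum_le_card_mul_sum_sq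

theorem eq_of_div_eq_of_modEq {d x y : ℕ} (h : x / d = y / d) (h' : x ≡ y [MOD d]) : x = y := by
  rw [← Nat.div_add_mod x d, ← Nat.div_add_mod y d, h, h']

theorem card_box_congruent_mul_le (U d₁ d₂ d₃ : ℕ) (h12 : d₁.Coprime d₂) (h13 : d₁.Coprime d₃)
    (h23 : d₂.Coprime d₃) (h1 : 1 ≤ d₁) (h2 : 1 ≤ d₂) (h3 : 1 ≤ d₃)
    (S : Finset (ℕ × ℕ × ℕ × ℕ))
    (hS : ∀ u ∈ S, u.1 < U ∧ u.2.1 < U ∧ u.2.2.1 < U ∧ u.2.2.2 < U)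
    (hne : ∀ u ∈ S, ¬ PairsUp u.1 u.2.1 u.2.2.1 u.2.2.2)
    (hd1 : ∀ u ∈ S, u.1 ≡ u.2.2.1 [MOD d₁] ∧ u.2.1 ≡ u.2.2.2 [MOD d₁])
    (hd2 : ∀ u ∈ S, u.1 ≡ u.2.2.2 [MOD d₂] ∧ u.2.1 ≡ u.2.2.1 [MOD d₂])
    (hd3 : ∀ u ∈ S, u.1 ≡ u.2.1 [MOD d₃] ∧ u.2.2.1 ≡ u.2.2.2 [MOD d₃]) :
    S.card * (d₁ * d₂ * d₃) ≤ 8 * U ^ 4 := by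
  rcases S.eq_empty_or_nonempty with rfl | ⟨u, hu⟩
  · simp
  have modlt : ∀ {d x y : ℕ}, x ≡ y [MOD d] → x < U → y < U → x ≠ y → d ≤ U := by
    intro d x y h hx hy hxy
    by_contra! hd
    exact hxy (Nat.ModEq.eq_of_lt_of_lt h (hx.trans hd) (hy.trans hd))
  obtain ⟨hu1, hu2, hu3, hu4⟩ := hS u hu
  have hn := hne u hu
  unfold PairsUp at hn
  push Not at hn
  obtain ⟨hn1, hn2, hn3⟩ := hn
  have b1 : d₁ ≤ U := by
    by_cases h : u.1 = u.2.2.1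
    · exact modlt (hd1 u hu).2 hu2 hu4 (hn1 h)
    · exact modlt (hd1 u hu).1 hu1 hu3 h
  have b2 : d₂ ≤ U := by
    by_cases h : u.1 = u.2.2.2
    · exact modlt (hd2 u hu).2 hu2 hu3 (hn2 h)
    · exact modlt (hd2 u hu).1 hu1 hu4 h
  have b3 : d₃ ≤ U := by
    by_cases h : u.1 = u.2.1
    · exact modlt (hd3 u hu).2 hu3 hu4 (hn3 h)
    · exact modlt (hd3 u hu).1 hu1 hu2 h
  have hcard : S.card ≤ U * ((U / d₃ + 1) * ((U / (d₁ * d₂) + 1) * (U / (d₁ * d₂ * d₃) + 1))) := by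
    suffices h : S.card ≤ (range U ×ˢ range (U / d₃ + 1) ×ˢ range (U / (d₁ * d₂) + 1) ×ˢ
        range (U / (d₁ * d₂ * d₃) + 1)).card by
      simpa only [Finset.card_product, Finset.card_range] using h
    refine Finset.card_le_card_of_injOn
      (fun u => (u.1, u.2.1 / d₃, u.2.2.1 / (d₁ * d₂), u.2.2.2 / (d₁ * d₂ * d₃))) ?_ ?_
    · intro u hu
      obtain ⟨hu1, hu2, hu3, hu4⟩ := hS u hu
      simp only [Finset.coe_product, Set.mem_prod, Finset.mem_coe, Finset.mem_range]
      exact ⟨hu1, Nat.lt_succ_of_le (Nat.div_le_div_right hu2.le),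
        Nat.lt_succ_of_le (Nat.div_le_div_right hu3.le),
        Nat.lt_succ_of_le (Nat.div_le_div_right hu4.le)⟩
    · rintro ⟨x1, x2, x3, x4⟩ hx ⟨y1, y2, y3, y4⟩ hy h
      simp only [Prod.mk.injEq] at h
      obtain ⟨rfl, e2, e3, e4⟩ := h
      have hx1 := hd1 _ hx; have hx2 := hd2 _ hx; have hx3 := hd3 _ hx
      have hy1 := hd1 _ hy; have hy2 := hd2 _ hy; have hy3 := hd3 _ hy
      simp only at hx1 hx2 hx3 hy1 hy2 hy3
      obtain rfl := eq_of_div_eq_of_modEq e2 (hx3.1.symm.trans hy3.1)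
      obtain rfl := eq_of_div_eq_of_modEq e3
        ((Nat.modEq_and_modEq_iff_modEq_mul h12).1
          ⟨hx1.1.symm.trans hy1.1, hx2.2.symm.trans hy2.2⟩)
      obtain rfl := eq_of_div_eq_of_modEq e4
        ((Nat.modEq_and_modEq_iff_modEq_mul (Nat.Coprime.mul_left h13 h23)).1
          ⟨(Nat.modEq_and_modEq_iff_modEq_mul h12).1
            ⟨hx1.2.symm.trans hy1.2, hx2.1.symm.trans hy2.1⟩, hx3.2.symm.trans hy3.2⟩)
      rfl
  have hU : 1 ≤ U := h1.trans b1
  have c3 : (U / d₃ + 1) * d₃ ≤ 2 * U := by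
    have := Nat.div_mul_le_self U d₃
    rw [add_mul]; omega
  have c12 : (U / (d₁ * d₂) + 1) * (d₁ * d₂) * (U / (d₁ * d₂ * d₃) + 1) ≤ 4 * U ^ 2 := by
    have t1 := Nat.div_mul_le_self U (d₁ * d₂)
    have t2 : U / (d₁ * d₂ * d₃) ≤ U / (d₁ * d₂) :=
      Nat.div_le_div_left (Nat.le_mul_of_pos_right _ h3) (by positivity)
    have t3 : d₁ * d₂ ≤ U * U := Nat.mul_le_mul b1 b2
    have t4 : U / (d₁ * d₂) ≤ U := Nat.div_le_self _ _
    have t5 : U ≤ U * U := Nat.le_mul_of_pos_left _ hU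
    generalize U / (d₁ * d₂) = k at *
    generalize U / (d₁ * d₂ * d₃) = l at *
    generalize d₁ * d₂ = d at *
    calc (k + 1) * d * (l + 1) = k * d * l + d * l + k * d + d := by ring
      _ ≤ U * U + U + U + U * U := by
          have : d * l ≤ d * k := Nat.mul_le_mul_left _ t2
          have : k * d * l ≤ U * U := Nat.mul_le_mul t1 (t2.trans t4)
          nlinarith
      _ ≤ 4 * U ^ 2 := by nlinarith
  calc S.card * (d₁ * d₂ * d₃)
      ≤ U * ((U / d₃ + 1) * ((U / (d₁ * d₂) + 1) * (U / (d₁ * d₂ * d₃) + 1))) * (d₁ * d₂ * d₃) :=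
        Nat.mul_le_mul_right _ hcard
    _ = U * (((U / d₃ + 1) * d₃) *
        ((U / (d₁ * d₂) + 1) * (d₁ * d₂) * (U / (d₁ * d₂ * d₃) + 1))) := by ring
    _ ≤ U * ((2 * U) * (4 * U ^ 2)) := by gcongr
    _ = 8 * U ^ 4 := by ring

theorem modEq_prod_of_forall {ι : Type*} (s : Finset ι) (d : ι → ℕ)
    (hd : (s : Set ι).Pairwise fun i j => (d i).Coprime (d j)) {x y : ℕ}
    (h : ∀ i ∈ s, x ≡ y [MOD d i]) : x ≡ y [MOD ∏ i ∈ s, d i] := by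
  rw [Nat.modEq_iff_dvd, Nat.cast_prod]
  exact Finset.prod_dvd_of_coprime (fun i hi j hj hij => Nat.isCoprime_iff_coprime.2 (hd hi hj hij))
    fun i hi => Nat.modEq_iff_dvd.1 (h i hi)

/-- The three ways of splitting four residues into equal pairs; index `0` is the empty
condition. -/
def PairingMod (d : ℕ) (u : ℕ × ℕ × ℕ × ℕ) : Fin 4 → Prop :=
  ![True, u.1 ≡ u.2.2.1 [MOD d] ∧ u.2.1 ≡ u.2.2.2 [MOD d],
    u.1 ≡ u.2.2.2 [MOD d] ∧ u.2.1 ≡ u.2.2.1 [MOD d],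
    u.1 ≡ u.2.1 [MOD d] ∧ u.2.2.1 ≡ u.2.2.2 [MOD d]]

/-- The quadruple `u` splits into two pairs of elements congruent modulo `d`. -/
def PairsUpMod (d : ℕ) (u : ℕ × ℕ × ℕ × ℕ) : Prop :=
  PairsUp (u.1 : ZMod d) (u.2.1 : ZMod d) (u.2.2.1 : ZMod d) (u.2.2.2 : ZMod d)

theorem pairsUpMod_iff {d : ℕ} {u : ℕ × ℕ × ℕ × ℕ} :
    PairsUpMod d u ↔ PairingMod d u 1 ∨ PairingMod d u 2 ∨ PairingMod d u 3 := by
  simp [PairsUpMod, PairsUp, PairingMod, ZMod.natCast_eq_natCast_iff]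

open Classical in
theorem sum_prod_pairsUpMod_le (q U D : ℕ) (hD : 1 ≤ D) :
    ∑ u ∈ (range U ×ˢ range U ×ˢ range U ×ˢ range U).filter
        (fun u => ¬ PairsUp u.1 u.2.1 u.2.2.1 u.2.2.2),
      ∏ p : q.primeFactors, (if PairsUpMod p u then (p : ℕ) + 1 else D + 1)
      ≤ 8 * (4 * (D + 1)) ^ q.primeFactors.card * U ^ 4 := by
  set B := (range U ×ˢ range U ×ˢ range U ×ˢ range U).filter
        (fun u => ¬ PairsUp u.1 u.2.1 u.2.2.1 u.2.2.2) with hB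
  have hprime : ∀ p : q.primeFactors, (p : ℕ).Prime := fun p => Nat.prime_of_mem_primeFactors p.2
  have hcop : ∀ i j : q.primeFactors, i ≠ j → (i : ℕ).Coprime j := fun i j hij =>
    (Nat.coprime_primes (hprime i) (hprime j)).2 fun h => hij (Subtype.ext h)
  let w : q.primeFactors → Fin 4 → ℕ := fun p j => if j = 0 then 1 else (p : ℕ)
  have step1 : ∀ u : ℕ × ℕ × ℕ × ℕ, ∀ p : q.primeFactors,
      (if PairsUpMod p u then (p : ℕ) + 1 else D + 1)
        ≤ (D + 1) * ∑ j : Fin 4, if PairingMod p u j then w p j else 0 := by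
    intro u p
    have h1 := (hprime p).one_lt
    have h0 : PairingMod p u 0 := by simp [PairingMod]
    have hw : ∀ j : Fin 4, j ≠ 0 → w p j = p := fun j hj => by simp [w, hj]
    have hw0 : w p 0 = 1 := by simp [w]
    have hbig : ∀ j : Fin 4, PairingMod p u j →
        w p j ≤ ∑ j : Fin 4, if PairingMod p u j then w p j else 0 := by
      intro j hj
      have := Finset.single_le_sum (f := fun j => if PairingMod p u j then w p j else 0)
        (fun _ _ => Nat.zero_le _) (Finset.mem_univ j)
      simpa [hj] using this
    split_ifs with h
    · have : (p : ℕ) ≤ ∑ j : Fin 4, if PairingMod p u j then w p j else 0 := by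
        rcases pairsUpMod_iff.1 h with h | h | h
        · exact (hw 1 (by decide)).symm.le.trans (hbig _ h)
        · exact (hw 2 (by decide)).symm.le.trans (hbig _ h)
        · exact (hw 3 (by decide)).symm.le.trans (hbig _ h)
      nlinarith
    · have := hbig 0 h0
      rw [hw0] at this
      exact Nat.le_mul_of_pos_right _ this
  have step2 : ∀ f : q.primeFactors → Fin 4,
      ∑ u ∈ B, ∏ p : q.primeFactors, (if PairingMod p u (f p) then w p (f p) else 0) ≤ 8 * U ^ 4 := by
    intro f
    let d : Fin 4 → ℕ := fun j => ∏ p ∈ univ.filter (fun p => f p = j), (p : ℕ)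
    have hprod : ∏ p, w p (f p) = d 1 * d 2 * d 3 := by
      rw [← Finset.prod_fiberwise univ f, Fin.prod_univ_four]
      have h0 : ∏ p ∈ univ.filter (fun p => f p = 0), w p (f p) = 1 :=
        Finset.prod_eq_one fun p hp => by simp [w, (Finset.mem_filter.1 hp).2]
      have hj : ∀ j : Fin 4, j ≠ 0 → ∏ p ∈ univ.filter (fun p => f p = j), w p (f p) = d j :=
        fun j hj => Finset.prod_congr rfl fun p hp => by simp [w, (Finset.mem_filter.1 hp).2, hj]
      rw [h0, hj 1 (by decide), hj 2 (by decide), hj 3 (by decide), one_mul]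
    have hdc : ∀ i j : Fin 4, i ≠ j → (d i).Coprime (d j) := fun i j hij =>
      Nat.Coprime.prod_left fun p hp => Nat.Coprime.prod_right fun r hr => hcop p r (by
        rintro rfl
        exact hij ((Finset.mem_filter.1 hp).2.symm.trans (Finset.mem_filter.1 hr).2))
    have hd1 : ∀ j, 1 ≤ d j := fun j => Nat.one_le_iff_ne_zero.2
      (Finset.prod_ne_zero_iff.2 fun p _ => (hprime p).ne_zero)
    have hmod : ∀ (j : Fin 4) (x y : ℕ), (∀ p : q.primeFactors, f p = j → x ≡ y [MOD p]) →
        x ≡ y [MOD d j] := fun j x y h =>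
      modEq_prod_of_forall _ _ (fun p _ r _ hpr => hcop p r hpr)
        fun p hp => h p (Finset.mem_filter.1 hp).2
    simp only [Finset.prod_ite_zero, Finset.mem_univ, true_implies]
    rw [← Finset.sum_filter, Finset.sum_const, smul_eq_mul, hprod]
    refine card_box_congruent_mul_le U _ _ _ (hdc 1 2 (by decide)) (hdc 1 3 (by decide))
      (hdc 2 3 (by decide)) (hd1 1) (hd1 2) (hd1 3) _ ?_ ?_ ?_ ?_ ?_
    · intro u hu
      simpa [hB, and_assoc] using (Finset.mem_filter.1 (Finset.mem_filter.1 hu).1).1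
    · exact fun u hu => (Finset.mem_filter.1 (Finset.mem_filter.1 hu).1).2
    all_goals
      intro u hu
      have h := (Finset.mem_filter.1 hu).2
      constructor <;>
      · refine hmod _ _ _ fun p hp => ?_
        have := h p
        rw [hp] at this
        simp only [PairingMod] at this
        first | exact this.1 | exact this.2
  calc _ ≤ ∑ u ∈ B, ∏ p : q.primeFactors,
        ((D + 1) * ∑ j : Fin 4, if PairingMod p u j then w p j else 0) :=
        Finset.sum_le_sum fun u _ => Finset.prod_le_prod' fun p _ => step1 u p
    _ = (D + 1) ^ q.primeFactors.card * ∑ f : q.primeFactors → Fin 4,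
          ∑ u ∈ B, ∏ p : q.primeFactors, (if PairingMod p u (f p) then w p (f p) else 0) := by
        rw [Finset.sum_comm, Finset.mul_sum]
        refine Finset.sum_congr rfl fun u _ => ?_
        rw [Finset.prod_mul_distrib, Finset.prod_const, Finset.prod_univ_sum,
          Fintype.piFinset_univ]
        simp
    _ ≤ (D + 1) ^ q.primeFactors.card * ∑ f : q.primeFactors → Fin 4, 8 * U ^ 4 := by
        gcongr with f _
        exact step2 f
    _ = 8 * (4 * (D + 1)) ^ q.primeFactors.card * U ^ 4 := by
        simp [mul_pow]; ring

theorem eq_of_mul_eq_mul_of_gcd_eq {w z : ℕ × ℕ} (hw : 1 ≤ w.1)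
    (hg : w.1.gcd w.2 = z.1.gcd z.2) (h : w.1 * z.2 = z.1 * w.2) : w = z := by
  have hpos : 0 < w.1.gcd w.2 := Nat.gcd_pos_of_pos_left _ hw
  have hpos' : 0 < z.1.gcd z.2 := hg ▸ hpos
  obtain ⟨a, b, hab, ha, hb⟩ := Nat.exists_coprime w.1 w.2
  obtain ⟨a', b', hab', ha', hb'⟩ := Nat.exists_coprime z.1 z.2
  have hcross : a * b' = a' * b := by
    rw [← hg] at ha' hb'
    generalize w.1.gcd w.2 = g at *
    rw [ha, hb, ha', hb'] at h
    exact Nat.eq_of_mul_eq_mul_left (Nat.mul_pos hpos hpos) (by linarith)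
  have hapos : 0 < a := by
    rcases Nat.eq_zero_or_pos a with rfl | h
    · omega
    · exact h
  obtain rfl : a = a' := Nat.dvd_antisymm
    (hab.dvd_of_dvd_mul_right (hcross ▸ dvd_mul_right a b'))
    (hab'.dvd_of_dvd_mul_right (hcross ▸ dvd_mul_right a' b))
  obtain rfl : b' = b := Nat.eq_of_mul_eq_mul_left hapos hcross
  exact Prod.ext (by rw [ha, ha', hg]) (by rw [hb, hb', hg])

/-- The points of the arithmetic progression `n, n - v, n - 2v, …` lying in `A`. -/
def progressionIndices (A : Finset ℕ) (U : ℕ) (w : ℕ × ℕ) : Finset ℕ :=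
  (range U).filter fun u => u * w.2 ≤ w.1 ∧ w.1 - u * w.2 ∈ A

open Classical in
/-- Nontrivial additive quadruples of a function on a finite set. -/
noncomputable def energyQuadruples (L : Finset ℕ) (h : ℕ → ℕ) : Finset (ℕ × ℕ × ℕ × ℕ) :=
  (L ×ˢ L ×ˢ L ×ˢ L).filter fun u =>
    ¬ PairsUp u.1 u.2.1 u.2.2.1 u.2.2.2 ∧ h u.1 + h u.2.1 = h u.2.2.1 + h u.2.2.2

theorem card_pow_four_le (L : Finset ℕ) (h : ℕ → ℕ) (Y : ℕ)
    (hh : ∀ u ∈ L, 1 ≤ h u ∧ h u ≤ Y) :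
    L.card ^ 4 ≤ 2 * Y * (3 * L.card ^ 2 + (energyQuadruples L h).card) := by
  classical
  have h1 := Finset.card_sq_le_card_mul_card_eq (L ×ˢ L) (Finset.Icc 1 (2 * Y))
    (fun z => h z.1 + h z.2) (by
      intro z hz
      have h1 := hh _ (Finset.mem_product.1 hz).1
      have h2 := hh _ (Finset.mem_product.1 hz).2
      simp only [Finset.mem_Icc]; omega)
  rw [Nat.card_Icc, Finset.card_product, Nat.add_sub_cancel] at h1
  have h2 : (((L ×ˢ L) ×ˢ (L ×ˢ L)).filter
      fun z => h z.1.1 + h z.1.2 = h z.2.1 + h z.2.2).card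
        ≤ 3 * L.card ^ 2 + (energyQuadruples L h).card := by
    have hsub : (((L ×ˢ L) ×ˢ (L ×ˢ L)).filter
        fun z => h z.1.1 + h z.1.2 = h z.2.1 + h z.2.2) ⊆
        ((L ×ˢ L).image (fun x => ((x.1, x.2), (x.1, x.2))) ∪
          (L ×ˢ L).image (fun x => ((x.1, x.2), (x.2, x.1))) ∪
          (L ×ˢ L).image (fun x => ((x.1, x.1), (x.2, x.2)))) ∪
        (energyQuadruples L h).image (fun u => ((u.1, u.2.1), (u.2.2.1, u.2.2.2))) := by
      rintro ⟨⟨a, b⟩, ⟨c, d⟩⟩ hz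
      simp only [Finset.mem_filter, Finset.mem_product] at hz
      obtain ⟨⟨⟨ha, hb⟩, hc, hd⟩, he⟩ := hz
      by_cases hp : PairsUp a b c d
      · refine Finset.mem_union_left _ ?_
        rcases hp with ⟨rfl, rfl⟩ | ⟨rfl, rfl⟩ | ⟨rfl, rfl⟩
        · refine Finset.mem_union_left _ (Finset.mem_union_left _ ?_)
          exact Finset.mem_image.2 ⟨(a, b), Finset.mem_product.2 ⟨ha, hb⟩, rfl⟩
        · refine Finset.mem_union_left _ (Finset.mem_union_right _ ?_)
          exact Finset.mem_image.2 ⟨(a, b), Finset.mem_product.2 ⟨ha, hb⟩, rfl⟩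
        · refine Finset.mem_union_right _ ?_
          exact Finset.mem_image.2 ⟨(a, c), Finset.mem_product.2 ⟨ha, hc⟩, rfl⟩
      · refine Finset.mem_union_right _ (Finset.mem_image.2 ⟨(a, b, c, d), ?_, rfl⟩)
        simp only [energyQuadruples, Finset.mem_filter, Finset.mem_product]
        exact ⟨⟨ha, hb, hc, hd⟩, hp, he⟩
    have hLL : (L ×ˢ L).card = L.card ^ 2 := by rw [Finset.card_product, sq]
    refine (Finset.card_le_card hsub).trans ((Finset.card_union_le _ _).trans
      (add_le_add ((Finset.card_union_le _ _).trans ?_) Finset.card_image_le))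
    calc _ ≤ ((L ×ˢ L).card + (L ×ˢ L).card) + (L ×ˢ L).card :=
          add_le_add ((Finset.card_union_le _ _).trans
            (add_le_add Finset.card_image_le Finset.card_image_le)) Finset.card_image_le
      _ = 3 * L.card ^ 2 := by rw [hLL]; ring
  calc L.card ^ 4 = (L.card * L.card) ^ 2 := by ring
    _ ≤ _ := h1
    _ ≤ _ := Nat.mul_le_mul_left _ h2

theorem le_sqrt_add_of_pow_four_le {J Y E : ℝ} (hJ : 0 ≤ J) (hY : 0 ≤ Y) (hE : 0 ≤ E)
    (h : J ^ 4 ≤ 2 * Y * (3 * J ^ 2 + E)) :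
    J ≤ 4 * √Y + (4 * Y * E) ^ (1 / 4 : ℝ) := by
  have hs := Real.sqrt_nonneg Y
  have hr : 0 ≤ (4 * Y * E) ^ (1 / 4 : ℝ) := by positivity
  by_cases hc : J ^ 2 ≤ 12 * Y
  · have : J ≤ 4 * √Y := by
      refine abs_le_of_sq_le_sq' ?_ (by positivity) |>.2
      rw [mul_pow, Real.sq_sqrt hY]; linarith
    linarith
  · have h4 : J ^ 4 ≤ 4 * Y * E := by nlinarith [sq_nonneg J]
    have : J ≤ (4 * Y * E) ^ (1 / 4 : ℝ) := by
      calc J = (J ^ 4) ^ (1 / 4 : ℝ) := by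
            rw [← Real.rpow_natCast, ← Real.rpow_mul hJ]; norm_num
        _ ≤ _ := Real.rpow_le_rpow (by positivity) h4 (by norm_num)
    linarith

theorem sum_rpow_fourth_le {α : Type*} (S : Finset α) (f : α → ℝ) (hf : ∀ x ∈ S, 0 ≤ f x) :
    ∑ x ∈ S, f x ^ (1 / 4 : ℝ) ≤ (S.card : ℝ) ^ (3 / 4 : ℝ) * (∑ x ∈ S, f x) ^ (1 / 4 : ℝ) := by
  have hg : ∀ x ∈ S, 0 ≤ f x ^ (1 / 4 : ℝ) := fun x hx => Real.rpow_nonneg (hf x hx) _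
  have key : (∑ x ∈ S, f x ^ (1 / 4 : ℝ)) ^ 4 ≤ (S.card : ℝ) ^ 3 * ∑ x ∈ S, f x := by
    have h1 := sq_sum_le_card_mul_sum_sq (s := S) (f := fun x => f x ^ (1 / 4 : ℝ))
    have h2 := sq_sum_le_card_mul_sum_sq (s := S) (f := fun x => (f x ^ (1 / 4 : ℝ)) ^ 2)
    have h3 : ∑ x ∈ S, ((f x ^ (1 / 4 : ℝ)) ^ 2) ^ 2 = ∑ x ∈ S, f x := by
      refine Finset.sum_congr rfl fun x hx => ?_
      rw [← pow_mul, ← Real.rpow_natCast, ← Real.rpow_mul (hf x hx)]; norm_num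
    rw [h3] at h2
    calc (∑ x ∈ S, f x ^ (1 / 4 : ℝ)) ^ 4 = ((∑ x ∈ S, f x ^ (1 / 4 : ℝ)) ^ 2) ^ 2 := by ring
      _ ≤ (S.card * ∑ x ∈ S, (f x ^ (1 / 4 : ℝ)) ^ 2) ^ 2 :=
          pow_le_pow_left₀ (sq_nonneg _) h1 2
      _ = (S.card : ℝ) ^ 2 * (∑ x ∈ S, (f x ^ (1 / 4 : ℝ)) ^ 2) ^ 2 := by ring
      _ ≤ (S.card : ℝ) ^ 2 * (S.card * ∑ x ∈ S, f x) := by gcongr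
      _ = _ := by ring
  have h0 : 0 ≤ ∑ x ∈ S, f x ^ (1 / 4 : ℝ) := Finset.sum_nonneg hg
  calc ∑ x ∈ S, f x ^ (1 / 4 : ℝ) = ((∑ x ∈ S, f x ^ (1 / 4 : ℝ)) ^ 4) ^ (1 / 4 : ℝ) := by
        rw [← Real.rpow_natCast _ 4, ← Real.rpow_mul h0]; norm_num
    _ ≤ ((S.card : ℝ) ^ 3 * ∑ x ∈ S, f x) ^ (1 / 4 : ℝ) :=
        Real.rpow_le_rpow (by positivity) key (by norm_num)
    _ = _ := by
        rw [Real.mul_rpow (by positivity) (Finset.sum_nonneg hf), ← Real.rpow_natCast _ 3,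
          ← Real.rpow_mul (by positivity)]
        norm_num

theorem card_mul_mul_le_sum_progressionIndices (A : Finset ℕ) (X U V : ℕ)
    (hA : ∀ α ∈ A, 1 ≤ α ∧ α ≤ X) (hUV : U * V ≤ X) :
    A.card * U * V ≤ ∑ w ∈ Icc 1 (2 * X) ×ˢ Icc 1 V, (progressionIndices A U w).card := by
  rw [← Finset.card_sigma]
  have : A.card * U * V = (A ×ˢ range U ×ˢ Icc 1 V).card := by simp [mul_assoc]
  rw [this]
  refine Finset.card_le_card_of_injOn
    (fun z => (⟨(z.1 + z.2.1 * z.2.2, z.2.2), z.2.1⟩ : (_ : ℕ × ℕ) × ℕ)) ?_ ?_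
  · rintro ⟨α, u, v⟩ hz
    simp only [Finset.coe_product, Set.mem_prod, Finset.mem_coe, Finset.mem_range,
      Finset.mem_Icc] at hz
    obtain ⟨hα, hu, hv1, hv2⟩ := hz
    have h1 := hA α hα
    have h2 : u * v ≤ X := (Nat.mul_le_mul hu.le hv2).trans hUV
    simp only [Finset.coe_sigma, Set.mem_sigma_iff, Finset.mem_coe, Finset.mem_product,
      Finset.mem_Icc, progressionIndices, Finset.mem_filter, Finset.mem_range,
      Nat.add_sub_cancel]
    refine ⟨⟨⟨by omega, by omega⟩, hv1, hv2⟩, hu, by omega, hα⟩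
  · rintro ⟨α, u, v⟩ _ ⟨α', u', v'⟩ _ h
    simp only [Sigma.mk.injEq, Prod.mk.injEq, heq_eq_eq] at h
    obtain ⟨⟨h1, rfl⟩, rfl⟩ := h
    simp only [Nat.add_right_cancel_iff] at h1
    rw [h1]

theorem card_filter_gcd_le (X V g : ℕ) (hg : 1 ≤ g) :
    (((Icc 1 X ×ˢ Icc 1 V).filter fun w : ℕ × ℕ => w.1.gcd w.2 = g).card : ℝ)
      ≤ (X * V : ℝ) / g ^ 2 := by
  have h1 : ((Icc 1 X ×ˢ Icc 1 V).filter fun w : ℕ × ℕ => w.1.gcd w.2 = g).card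
      ≤ (X / g) * (V / g) := by
    have : (X / g) * (V / g) = (Icc 1 (X / g) ×ˢ Icc 1 (V / g)).card := by simp
    rw [this]
    refine Finset.card_le_card_of_injOn (fun w => (w.1 / g, w.2 / g)) ?_ ?_
    · rintro ⟨n, v⟩ hw
      simp only [Finset.coe_filter, Finset.mem_product, Finset.mem_Icc, Set.mem_ofPred_eq] at hw
      obtain ⟨⟨⟨hn1, hn2⟩, hv1, hv2⟩, rfl⟩ := hw
      simp only [Finset.coe_product, Set.mem_prod, Finset.mem_coe, Finset.mem_Icc]
      exact ⟨⟨Nat.div_pos (Nat.gcd_le_left _ hn1) hg, Nat.div_le_div_right hn2⟩,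
        Nat.div_pos (Nat.gcd_le_right _ hv1) hg, Nat.div_le_div_right hv2⟩
    · rintro ⟨n, v⟩ hw ⟨n', v'⟩ hw' h
      simp only [Finset.coe_filter, Set.mem_ofPred_eq] at hw hw'
      simp only [Prod.mk.injEq] at h
      have a1 := Nat.gcd_dvd_left n v
      have a2 := Nat.gcd_dvd_right n v
      have b1 := Nat.gcd_dvd_left n' v'
      have b2 := Nat.gcd_dvd_right n' v'
      rw [hw.2] at a1 a2
      rw [hw'.2] at b1 b2
      rw [Prod.mk.injEq]
      exact ⟨(Nat.div_left_inj a1 b1).1 h.1, (Nat.div_left_inj a2 b2).1 h.2⟩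
  have hg' : (0 : ℝ) < g := by exact_mod_cast hg
  calc _ ≤ (((X / g) * (V / g) : ℕ) : ℝ) := by exact_mod_cast h1
    _ ≤ (X / g : ℝ) * (V / g : ℝ) := by
        rw [Nat.cast_mul]
        exact mul_le_mul Nat.cast_div_le Nat.cast_div_le (by positivity) (by positivity)
    _ = _ := by field_simp

/-- For a quadruple `u` that does not split into pairs modulo a prime `p ∣ q`, four points
`n - uᵢ v` of `A` at which `β` forms an additive quadruple determine `n / v` modulo `p` up to `D`
possibilities. -/
def DeterminesSlopes (q D : ℕ) (A : Finset ℕ) (β : ℕ → ℕ) : Prop :=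
  ∀ p : ℕ, p.Prime → p ∣ q → ∀ u : ℕ × ℕ × ℕ × ℕ, ¬ PairsUpMod p u →
    ∃ R : Finset (ZMod p), R.card ≤ D ∧ ∀ n v α₁ α₂ α₃ α₄ : ℕ, (v : ZMod p) ≠ 0 →
      α₁ ∈ A → α₂ ∈ A → α₃ ∈ A → α₄ ∈ A → α₁ + u.1 * v = n → α₂ + u.2.1 * v = n →
      α₃ + u.2.2.1 * v = n → α₄ + u.2.2.2 * v = n → β α₁ + β α₂ = β α₃ + β α₄ →
      (n : ZMod p) * (v : ZMod p)⁻¹ ∈ R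

open Classical in
theorem card_filter_mem_energyQuadruples_le {q D : ℕ} (hq : Squarefree q) {A : Finset ℕ}
    {β : ℕ → ℕ} (hslope : DeterminesSlopes q D A β) {X V : ℕ} (hXV : X * V < q) (U g : ℕ)
    (u : ℕ × ℕ × ℕ × ℕ) :
    (((Icc 1 X ×ˢ Icc 1 V).filter fun w : ℕ × ℕ => w.1.gcd w.2 = g).filter fun w =>
      u ∈ energyQuadruples (progressionIndices A U w) fun x => β (w.1 - x * w.2)).card
      ≤ ∏ p : q.primeFactors, (if PairsUpMod p u then (p : ℕ) + 1 else D + 1) := by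
  set S := ((Icc 1 X ×ˢ Icc 1 V).filter fun w : ℕ × ℕ => w.1.gcd w.2 = g).filter fun w =>
      u ∈ energyQuadruples (progressionIndices A U w) fun x => β (w.1 - x * w.2) with hS
  have hprime : ∀ p : q.primeFactors, (p : ℕ).Prime := fun p => Nat.prime_of_mem_primeFactors p.2
  have hmem : ∀ w ∈ S, (1 ≤ w.1 ∧ w.1 ≤ X) ∧ (1 ≤ w.2 ∧ w.2 ≤ V) ∧ w.1.gcd w.2 = g := by
    intro w hw
    have := Finset.mem_filter.1 (Finset.mem_filter.1 hw).1
    simp only [Finset.mem_product, Finset.mem_Icc] at this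
    exact ⟨this.1.1, this.1.2, this.2⟩
  refine Finset.card_le_prod_of_injOn S
    (fun (p : q.primeFactors) (w : ℕ × ℕ) =>
      if (w.2 : ZMod p) = 0 then none else some ((w.1 : ZMod p) * (w.2 : ZMod p)⁻¹)) _ ?_ ?_
  · intro w hw z hz h
    obtain ⟨⟨hw1, hw2⟩, ⟨hw3, hw4⟩, hw5⟩ := hmem w hw
    obtain ⟨⟨hz1, hz2⟩, ⟨hz3, hz4⟩, hz5⟩ := hmem z hz
    refine eq_of_mul_eq_mul_of_gcd_eq hw1 (hw5.trans hz5.symm) ?_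
    have hdvd : (q : ℤ) ∣ (w.1 : ℤ) * z.2 - z.1 * w.2 := by
      refine hq.intCast_dvd_of_forall_primeFactors fun p hp => ?_
      have := Fact.mk (hprime ⟨p, hp⟩)
      have h := h ⟨p, hp⟩
      simp only at this h
      rw [← ZMod.intCast_zmod_eq_zero_iff_dvd]
      push_cast
      split_ifs at h with c1 c2 c2
      · rw [c1, c2]; ring
      · have h := Option.some.inj h
        field_simp at h
        rw [h]; ring
    have h1 : w.1 * z.2 < q := (Nat.mul_le_mul hw2 hz4).trans_lt hXV
    have h2 : z.1 * w.2 < q := (Nat.mul_le_mul hz2 hw4).trans_lt hXV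
    have h3 : (w.1 : ℤ) * z.2 - z.1 * w.2 = 0 := by
      refine Int.eq_zero_of_abs_lt_dvd hdvd ?_
      rw [abs_lt]
      zify at h1 h2
      constructor <;> nlinarith
    zify
    linarith
  · intro p
    have := Fact.mk (hprime p)
    split_ifs with hp
    · refine (Finset.card_le_univ _).trans ?_
      rw [Fintype.card_option, ZMod.card]
    · obtain ⟨R, hR, hRmem⟩ := hslope p (hprime p) (Nat.dvd_of_mem_primeFactors p.2) u hp
      calc _ ≤ (insert none (R.image some)).card := by
            refine Finset.card_le_card ?_
            intro o ho
            obtain ⟨w, hw, rfl⟩ := Finset.mem_image.1 ho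
            split_ifs with h0
            · exact Finset.mem_insert_self _ _
            · refine Finset.mem_insert_of_mem (Finset.mem_image_of_mem _ ?_)
              have hu := (Finset.mem_filter.1 hw).2
              simp only [energyQuadruples, progressionIndices, Finset.mem_filter,
                Finset.mem_product, Finset.mem_range] at hu
              obtain ⟨⟨⟨-, a1, a1'⟩, ⟨-, a2, a2'⟩, ⟨-, a3, a3'⟩, ⟨-, a4, a4'⟩⟩, -, he⟩ := hu
              exact hRmem w.1 w.2 _ _ _ _ h0 a1' a2' a3' a4' (Nat.sub_add_cancel a1)
                (Nat.sub_add_cancel a2) (Nat.sub_add_cancel a3) (Nat.sub_add_cancel a4) he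
        _ ≤ R.card + 1 := (Finset.card_insert_le _ _).trans
            (Nat.add_le_add_right Finset.card_image_le 1)
        _ ≤ D + 1 := by omega

open Classical in
theorem sum_card_energyQuadruples_le {q D : ℕ} (hq : Squarefree q) (hD : 1 ≤ D) {A : Finset ℕ}
    {β : ℕ → ℕ} (hslope : DeterminesSlopes q D A β) {X V : ℕ} (hXV : X * V < q) (U g : ℕ) :
    ∑ w ∈ (Icc 1 X ×ˢ Icc 1 V).filter (fun w : ℕ × ℕ => w.1.gcd w.2 = g),
      (energyQuadruples (progressionIndices A U w) fun x => β (w.1 - x * w.2)).card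
      ≤ 8 * (4 * (D + 1)) ^ q.primeFactors.card * U ^ 4 := by
  set B := (range U ×ˢ range U ×ˢ range U ×ˢ range U).filter
        (fun u => ¬ PairsUp u.1 u.2.1 u.2.2.1 u.2.2.2) with hB
  have hsub : ∀ w : ℕ × ℕ, energyQuadruples (progressionIndices A U w)
      (fun x => β (w.1 - x * w.2)) ⊆ B := by
    intro w u hu
    simp only [energyQuadruples, progressionIndices, Finset.mem_filter, Finset.mem_product] at hu
    simp only [hB, Finset.mem_filter, Finset.mem_product]
    exact ⟨⟨hu.1.1.1, hu.1.2.1.1, hu.1.2.2.1.1, hu.1.2.2.2.1⟩, hu.2.1⟩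
  refine le_trans ?_ (sum_prod_pairsUpMod_le q U D hD)
  calc _ = ∑ w ∈ (Icc 1 X ×ˢ Icc 1 V).filter (fun w : ℕ × ℕ => w.1.gcd w.2 = g), ∑ u ∈ B,
        (if u ∈ energyQuadruples (progressionIndices A U w)
          (fun x => β (w.1 - x * w.2)) then 1 else 0) := by
        refine Finset.sum_congr rfl fun w _ => ?_
        rw [← Finset.card_filter]
        congr 1
        ext u
        simp only [Finset.mem_filter]
        exact ⟨fun h => ⟨hsub w h, h⟩, fun h => h.2⟩
    _ ≤ _ := by
        rw [Finset.sum_comm]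
        refine Finset.sum_le_sum fun u _ => ?_
        rw [← Finset.card_filter]
        exact card_filter_mem_energyQuadruples_le hq hslope hXV U g u

/-- A set on which the slopes are determined meets few points on lines. -/
theorem exists_card_mul_mul_le : ∃ Z : ℝ, 0 < Z ∧ ∀ (q D X Y U V : ℕ) (A : Finset ℕ)
    (β : ℕ → ℕ), Squarefree q → 1 ≤ D → (∀ α ∈ A, 1 ≤ α ∧ α ≤ X) →
    (∀ α ∈ A, 1 ≤ β α ∧ β α ≤ Y) → DeterminesSlopes q D A β → U * V ≤ X → 2 * X * V < q →
    (A.card : ℝ) * U * V ≤ 8 * √Y * (X * V) + Z * (2 * X * V : ℝ) ^ (3 / 4 : ℝ) *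
      (32 * Y * (4 * (D + 1) : ℝ) ^ q.primeFactors.card * (U : ℝ) ^ 4) ^ (1 / 4 : ℝ) := by
  have hsum : Summable fun g : ℕ => ((g : ℝ) ^ (3 / 2 : ℝ))⁻¹ :=
    Real.summable_nat_rpow_inv.2 (by norm_num)
  refine ⟨∑' g : ℕ, ((g : ℝ) ^ (3 / 2 : ℝ))⁻¹, hsum.tsum_pos (fun _ => by positivity) 1
    (by norm_num), ?_⟩
  intro q D X Y U V A β hq hD hA hβ hslope hUV hXV
  set Z := ∑' g : ℕ, ((g : ℝ) ^ (3 / 2 : ℝ))⁻¹ with hZ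
  set W := Icc 1 (2 * X) ×ˢ Icc 1 V with hW
  obtain ⟨E, hE1, hE2⟩ : ∃ E : ℕ × ℕ → ℕ,
      (∀ w, (progressionIndices A U w).card ^ 4
        ≤ 2 * Y * (3 * (progressionIndices A U w).card ^ 2 + E w)) ∧
      ∀ g, ∑ w ∈ W.filter (fun w => w.1.gcd w.2 = g), E w
        ≤ 8 * (4 * (D + 1)) ^ q.primeFactors.card * U ^ 4 :=
    ⟨fun w => (energyQuadruples (progressionIndices A U w) fun x => β (w.1 - x * w.2)).card,
      fun w => card_pow_four_le _ _ Y fun u hu => hβ _ (Finset.mem_filter.1 hu).2.2,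
      fun g => sum_card_energyQuadruples_le hq hD hslope hXV U g⟩
  set Q : ℝ := 32 * Y * (4 * (D + 1) : ℝ) ^ q.primeFactors.card * (U : ℝ) ^ 4 with hQ
  have hQ0 : 0 ≤ Q := by positivity
  clear_value Z
  have hpt : ∀ w : ℕ × ℕ, ((progressionIndices A U w).card : ℝ)
      ≤ 4 * √Y + (4 * (Y : ℝ) * E w) ^ (1 / 4 : ℝ) := by
    intro w
    refine le_sqrt_add_of_pow_four_le (by positivity) (by positivity) (by positivity) ?_
    exact_mod_cast hE1 w
  have hfib : ∀ g ∈ Icc 1 V, ∑ w ∈ W.filter (fun w => w.1.gcd w.2 = g),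
      (4 * (Y : ℝ) * E w) ^ (1 / 4 : ℝ)
        ≤ (2 * X * V : ℝ) ^ (3 / 4 : ℝ) * Q ^ (1 / 4 : ℝ) * ((g : ℝ) ^ (3 / 2 : ℝ))⁻¹ := by
    intro g hg
    have hg1 := (Finset.mem_Icc.1 hg).1
    have hg0 : (0 : ℝ) < g := by exact_mod_cast hg1
    have h1 := card_filter_gcd_le (2 * X) V g hg1
    have h2 : ∑ w ∈ W.filter (fun w => w.1.gcd w.2 = g), 4 * (Y : ℝ) * E w ≤ Q := by
      rw [← Finset.mul_sum]
      have h3 : ∑ w ∈ W.filter (fun w => w.1.gcd w.2 = g), (E w : ℝ)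
          ≤ 8 * (4 * (D + 1) : ℝ) ^ q.primeFactors.card * (U : ℝ) ^ 4 := by
        exact_mod_cast hE2 g
      calc _ ≤ 4 * (Y : ℝ) * (8 * (4 * (D + 1) : ℝ) ^ q.primeFactors.card * (U : ℝ) ^ 4) := by
            gcongr
        _ = Q := by rw [hQ]; ring
    calc _ ≤ ((W.filter (fun w => w.1.gcd w.2 = g)).card : ℝ) ^ (3 / 4 : ℝ) *
          (∑ w ∈ W.filter (fun w => w.1.gcd w.2 = g), 4 * (Y : ℝ) * E w) ^ (1 / 4 : ℝ) :=
          sum_rpow_fourth_le _ _ fun w _ => by positivity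
      _ ≤ ((2 * X * V : ℝ) / g ^ 2) ^ (3 / 4 : ℝ) * Q ^ (1 / 4 : ℝ) := by
          gcongr
          exact_mod_cast h1
      _ = _ := by
          rw [Real.div_rpow (by positivity) (by positivity), ← Real.rpow_natCast _ 2,
            ← Real.rpow_mul hg0.le]
          norm_num
          ring
  have hmaps : ∀ w ∈ W, w.1.gcd w.2 ∈ Icc 1 V := by
    intro w hw
    simp only [hW, Finset.mem_product, Finset.mem_Icc] at hw
    exact Finset.mem_Icc.2 ⟨Nat.gcd_pos_of_pos_left _ hw.1.1,
      (Nat.gcd_le_right _ hw.2.1).trans hw.2.2⟩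
  have hE : ∑ w ∈ W, (4 * (Y : ℝ) * E w) ^ (1 / 4 : ℝ)
      ≤ Z * (2 * X * V : ℝ) ^ (3 / 4 : ℝ) * Q ^ (1 / 4 : ℝ) := by
    rw [← Finset.sum_fiberwise_of_maps_to hmaps]
    refine (Finset.sum_le_sum hfib).trans ?_
    rw [← Finset.mul_sum]
    have := hsum.sum_le_tsum (Icc 1 V) fun _ _ => by positivity
    rw [← hZ] at this
    calc _ ≤ (2 * X * V : ℝ) ^ (3 / 4 : ℝ) * Q ^ (1 / 4 : ℝ) * Z := by gcongr
      _ = _ := by ring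
  have htotal : (A.card : ℝ) * U * V ≤ ∑ w ∈ W, ((progressionIndices A U w).card : ℝ) := by
    exact_mod_cast card_mul_mul_le_sum_progressionIndices A X U V hA hUV
  calc _ ≤ _ := htotal
    _ ≤ ∑ w ∈ W, (4 * √Y + (4 * (Y : ℝ) * E w) ^ (1 / 4 : ℝ)) := Finset.sum_le_sum fun w _ => hpt w
    _ = 8 * √Y * (X * V) + ∑ w ∈ W, (4 * (Y : ℝ) * E w) ^ (1 / 4 : ℝ) := by
        rw [Finset.sum_add_distrib]
        simp [hW]
        ring
    _ ≤ _ := by gcongr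

theorem exists_card_le_of_determinesSlopes : ∃ C : ℝ, 0 < C ∧ ∀ (q : ℕ) (s b : ℝ)
    (A : Finset ℕ) (β : ℕ → ℕ), Squarefree q → 1 ≤ s → s ^ 4 ≤ q → 1 ≤ b →
    (∀ α ∈ A, 1 ≤ α ∧ (α : ℝ) ≤ 2 * s ^ 3) → (∀ α ∈ A, 1 ≤ β α ∧ (β α : ℝ) ≤ 2 * b ^ 4) →
    DeterminesSlopes q 12 A β →
    (A.card : ℝ) ≤ C * 52 ^ q.primeFactors.card * (s * b ^ 2 + s ^ 2 * b) := by
  obtain ⟨Z, hZ, hmain⟩ := exists_card_mul_mul_le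
  refine ⟨64 + 16 * Z, by positivity, ?_⟩
  intro q s b A β hq hs hsq hb hA hβ hslope
  set K : ℝ := 52 ^ q.primeFactors.card with hK
  have hK1 : 1 ≤ K := one_le_pow₀ (by norm_num)
  have hs0 : 0 < s := by linarith
  have hb0 : 0 < b := by linarith
  set X := ⌊2 * s ^ 3⌋₊ with hX
  set Y := ⌊2 * b ^ 4⌋₊ with hY
  have hXle : (X : ℝ) ≤ 2 * s ^ 3 := Nat.floor_le (by positivity)
  have hYle : (Y : ℝ) ≤ 2 * b ^ 4 := Nat.floor_le (by positivity)
  have hA' : ∀ α ∈ A, 1 ≤ α ∧ α ≤ X := fun α hα => ⟨(hA α hα).1, Nat.le_floor (hA α hα).2⟩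
  have hβ' : ∀ α ∈ A, 1 ≤ β α ∧ β α ≤ Y := fun α hα => ⟨(hβ α hα).1, Nat.le_floor (hβ α hα).2⟩
  have hfac : 16 * s ^ 2 * b ≤ (64 + 16 * Z) * K * (s * b ^ 2 + s ^ 2 * b) := by
    calc 16 * s ^ 2 * b = 16 * 1 * (0 + s ^ 2 * b) := by ring
      _ ≤ (64 + 16 * Z) * K * (s * b ^ 2 + s ^ 2 * b) := by
          gcongr
          · linarith
          · positivity
  rcases lt_or_ge s 8 with hs8 | hs8
  · have h1 : A.card ≤ X := by
      calc A.card ≤ (Icc 1 X).card := Finset.card_le_card fun α hα => Finset.mem_Icc.2 (hA' α hα)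
        _ = X := by simp
    refine le_trans ?_ hfac
    calc (A.card : ℝ) ≤ X := by exact_mod_cast h1
      _ ≤ 2 * s ^ 3 := hXle
      _ = 2 * s * s ^ 2 * 1 := by ring
      _ ≤ 16 * s ^ 2 * b := by gcongr; linarith
  set U := ⌊s ^ 2⌋₊ with hU
  set V := ⌊s / 8⌋₊ with hV
  have hUle : (U : ℝ) ≤ s ^ 2 := Nat.floor_le (by positivity)
  have hVle : (V : ℝ) ≤ s / 8 := Nat.floor_le (by positivity)
  have hUge : s ^ 2 ≤ 2 * U := by
    have := Nat.lt_floor_add_one (s ^ 2)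
    nlinarith
  have hV1 : (1 : ℝ) ≤ V := by
    exact_mod_cast Nat.le_floor (by push_cast; linarith : ((1 : ℕ) : ℝ) ≤ s / 8)
  have hVge : s ≤ 16 * V := by
    have := Nat.lt_floor_add_one (s / 8)
    linarith
  have hU0 : (0 : ℝ) < U := by nlinarith
  have hUV : U * V ≤ X := by
    refine Nat.le_floor ?_
    push_cast
    calc (U : ℝ) * V ≤ s ^ 2 * (s / 8) := by gcongr
      _ ≤ 2 * s ^ 3 := by nlinarith [pow_pos hs0 3]
  have hXV : 2 * X * V < q := by
    have : (2 * X * V : ℝ) < q := by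
      calc (2 * X * V : ℝ) ≤ 2 * (2 * s ^ 3) * (s / 8) := by gcongr
        _ = s ^ 4 / 2 := by ring
        _ < s ^ 4 := by linarith [pow_pos hs0 4]
        _ ≤ q := hsq
    exact_mod_cast this
  have key := hmain q 12 X Y U V A β hq (by norm_num) hA' hβ' hslope hUV hXV
  have hsqrt : √Y ≤ 2 * b ^ 2 := by
    refine Real.sqrt_le_iff.2 ⟨by positivity, ?_⟩
    nlinarith [pow_pos hb0 4]
  have t1 : 8 * √Y * (X * V) ≤ 64 * (s * b ^ 2) * (U * V) := by
    calc 8 * √Y * (X * V) ≤ 8 * (2 * b ^ 2) * ((2 * s ^ 3) * V) := by gcongr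
      _ = 32 * s * b ^ 2 * V * s ^ 2 := by ring
      _ ≤ 32 * s * b ^ 2 * V * (2 * U) := by gcongr
      _ = _ := by ring
  have t2 : (2 * X * V : ℝ) ^ (3 / 4 : ℝ) *
      (32 * Y * (4 * ((12 : ℕ) + 1) : ℝ) ^ q.primeFactors.card * (U : ℝ) ^ 4) ^ (1 / 4 : ℝ)
      ≤ 16 * K * (s ^ 2 * b) * (U * V) := by
    have e : (4 * ((12 : ℕ) + 1) : ℝ) = 52 := by norm_num
    rw [e, ← hK]
    have hpow : (2 * X * V : ℝ) ^ 3 * (32 * Y * K * (U : ℝ) ^ 4)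
        ≤ (16 * K * (s ^ 2 * b) * (U * V)) ^ 4 := by
      calc (2 * X * V : ℝ) ^ 3 * (32 * Y * K * (U : ℝ) ^ 4)
          ≤ (2 * (2 * s ^ 3) * V) ^ 3 * (32 * (2 * b ^ 4) * K * (U : ℝ) ^ 4) := by gcongr
        _ = 4096 * s ^ 8 * b ^ 4 * V ^ 3 * U ^ 4 * K * s := by ring
        _ ≤ 4096 * s ^ 8 * b ^ 4 * V ^ 3 * U ^ 4 * K ^ 4 * (16 * V) := by
            have : K ≤ K ^ 4 := le_self_pow₀ hK1 (by norm_num)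
            gcongr
        _ = _ := by ring
    calc _ = ((2 * X * V : ℝ) ^ 3 * (32 * Y * K * (U : ℝ) ^ 4)) ^ (1 / 4 : ℝ) := by
          rw [Real.mul_rpow (x := (2 * X * V : ℝ) ^ 3) (by positivity) (by positivity),
            ← Real.rpow_natCast _ 3, ← Real.rpow_mul (by positivity)]
          norm_num
      _ ≤ ((16 * K * (s ^ 2 * b) * (U * V)) ^ 4) ^ (1 / 4 : ℝ) :=
          Real.rpow_le_rpow (by positivity) hpow (by norm_num)
      _ = _ := by
          rw [← Real.rpow_natCast _ 4, ← Real.rpow_mul (by positivity)]; norm_num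
  have hUV0 : (0 : ℝ) < U * V := by positivity
  refine le_of_mul_le_mul_right ?_ hUV0
  calc (A.card : ℝ) * (U * V) ≤ 64 * (s * b ^ 2) * (U * V) +
        Z * (16 * K * (s ^ 2 * b) * (U * V)) := by
        rw [← mul_assoc]
        rw [mul_assoc Z] at key
        exact key.trans (add_le_add t1 (by gcongr))
    _ ≤ 64 * (s * b ^ 2) * (U * V) + Z * (16 * K * (s ^ 2 * b) * (U * V)) +
          (64 * (K - 1) * (s * b ^ 2) + 16 * Z * K * (s * b ^ 2) + 64 * K * (s ^ 2 * b))
            * (U * V) := by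
        have : 0 ≤ K - 1 := by linarith
        exact le_add_of_nonneg_right (by positivity)
    _ = _ := by ring

/-- The divisor-type bound `κ ^ ω(q) ≪ q ^ ε`. -/
theorem exists_pow_card_primeFactors_le (κ ε : ℝ) (hκ : 1 ≤ κ) (hε : 0 < ε) :
    ∃ C : ℝ, 0 < C ∧ ∀ q : ℕ, Squarefree q → κ ^ q.primeFactors.card ≤ C * (q : ℝ) ^ ε := by
  have hκ0 : 0 < κ := by linarith
  set T := ⌈κ ^ (1 / ε)⌉₊ with hT
  refine ⟨κ ^ T, by positivity, fun q hq => ?_⟩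
  have hp : ∀ p ∈ q.primeFactors, κ ≤ (if p < T then κ else 1) * (p : ℝ) ^ ε := by
    intro p hp
    have hp1 : (1 : ℝ) ≤ p := by exact_mod_cast (Nat.prime_of_mem_primeFactors hp).one_lt.le
    split_ifs with h
    · exact le_mul_of_one_le_right hκ0.le (Real.one_le_rpow hp1 hε.le)
    · rw [one_mul]
      calc κ = (κ ^ (1 / ε)) ^ ε := by
            rw [← Real.rpow_mul hκ0.le, one_div_mul_cancel hε.ne', Real.rpow_one]
        _ ≤ (p : ℝ) ^ ε := Real.rpow_le_rpow (by positivity)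
            ((Nat.le_ceil _).trans (by exact_mod_cast not_lt.1 h)) hε.le
  calc κ ^ q.primeFactors.card = ∏ p ∈ q.primeFactors, κ := by simp
    _ ≤ ∏ p ∈ q.primeFactors, ((if p < T then κ else 1) * (p : ℝ) ^ ε) :=
        Finset.prod_le_prod (fun _ _ => hκ0.le) hp
    _ = κ ^ (q.primeFactors.filter (· < T)).card * (q : ℝ) ^ ε := by
        rw [Finset.prod_mul_distrib, Finset.prod_ite, Finset.prod_const_one, Finset.prod_const,
          mul_one, Real.finsetProd_rpow _ _ (fun _ _ => by positivity), ← Nat.cast_prod,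
          Nat.prod_primeFactors_of_squarefree hq]
    _ ≤ κ ^ T * (q : ℝ) ^ ε := by
        gcongr
        calc _ ≤ (range T).card := Finset.card_le_card fun p hp =>
              Finset.mem_range.2 (Finset.mem_filter.1 hp).2
          _ = T := Finset.card_range T

theorem natCast_mul_sq_eq_of_dvd {q p : ℕ} (hp : p ∣ q) {m n : ℕ} {a : ℤ}
    (h : (m : ZMod q) * (n : ZMod q) ^ 2 = (a : ZMod q)) :
    (m : ZMod p) * (n : ZMod p) ^ 2 = (a : ZMod p) := by
  simpa only [map_mul, map_pow, map_natCast, map_intCast] using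
    congrArg (ZMod.castHom hp (ZMod p)) h

theorem intCast_ne_zero_of_gcd_eq_one {q p : ℕ} (hp : p.Prime) (hpq : p ∣ q) {a : ℤ}
    (ha : Int.gcd a q = 1) : (a : ZMod p) ≠ 0 := by
  rw [Ne, ZMod.intCast_zmod_eq_zero_iff_dvd]
  intro h
  have : (p : ℤ) ∣ (Int.gcd a q : ℤ) := Int.dvd_coe_gcd h (Int.natCast_dvd_natCast.2 hpq)
  rw [ha] at this
  exact hp.one_lt.ne' (Nat.dvd_one.1 (by exact_mod_cast this))

theorem determinesSlopes_of_mul_sq_eq {q : ℕ} {a : ℤ} (ha : Int.gcd a q = 1) {A : Finset ℕ}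
    {β : ℕ → ℕ} (h : ∀ α ∈ A, (α : ZMod q) * (β α : ZMod q) ^ 2 = (a : ZMod q)) :
    DeterminesSlopes q 12 A β := by
  intro p hp hpq u hu
  have := Fact.mk hp
  obtain ⟨R, hR, hmem⟩ := exists_finset_inverse_square_roots hu
  refine ⟨R, hR, ?_⟩
  intro n v α₁ α₂ α₃ α₄ hv m1 m2 m3 m4 e1 e2 e3 e4 he
  have hs : (a : ZMod p) * (v : ZMod p)⁻¹ ≠ 0 :=
    mul_ne_zero (intCast_ne_zero_of_gcd_eq_one hp hpq ha) (inv_ne_zero hv)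
  have hpt : ∀ (α x : ℕ), α ∈ A → α + x * v = n →
      (β α : ZMod p) ^ 2 * ((n : ZMod p) * (v : ZMod p)⁻¹ - x) = a * (v : ZMod p)⁻¹ := by
    intro α x hα hx
    rw [← natCast_mul_sq_eq_of_dvd hpq (h α hα), ← hx]
    push_cast
    field_simp
    ring
  exact hmem _ _ _ _ _ _ hs (hpt _ _ m1 e1) (hpt _ _ m2 e2) (hpt _ _ m3 e3) (hpt _ _ m4 e4)
    (by exact_mod_cast congrArg (Nat.cast : ℕ → ZMod p) he)

theorem determinesSlopes_of_sq_mul_eq {q : ℕ} {a : ℤ} (ha : Int.gcd a q = 1) {A : Finset ℕ}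
    {β : ℕ → ℕ} (h : ∀ α ∈ A, (β α : ZMod q) * (α : ZMod q) ^ 2 = (a : ZMod q)) :
    DeterminesSlopes q 12 A β := by
  intro p hp hpq u hu
  have := Fact.mk hp
  obtain ⟨R, hR, hmem⟩ := exists_finset_inverse_squares hu
  refine ⟨R, hR, ?_⟩
  intro n v α₁ α₂ α₃ α₄ hv m1 m2 m3 m4 e1 e2 e3 e4 he
  have hs : (a : ZMod p) * ((v : ZMod p) ^ 2)⁻¹ ≠ 0 :=
    mul_ne_zero (intCast_ne_zero_of_gcd_eq_one hp hpq ha) (inv_ne_zero (pow_ne_zero 2 hv))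
  have hpt : ∀ (α x : ℕ), α ∈ A → α + x * v = n →
      (β α : ZMod p) * ((n : ZMod p) * (v : ZMod p)⁻¹ - x) ^ 2 = a * ((v : ZMod p) ^ 2)⁻¹ := by
    intro α x hα hx
    rw [← natCast_mul_sq_eq_of_dvd hpq (h α hα), ← hx]
    push_cast
    field_simp
    ring
  exact hmem _ _ _ _ _ _ hs (hpt _ _ m1 e1) (hpt _ _ m2 e2) (hpt _ _ m3 e3) (hpt _ _ m4 e4)
    (by exact_mod_cast congrArg (Nat.cast : ℕ → ZMod p) he)

theorem eq_of_forall_primeFactors_natCast_eq {q : ℕ} (hq : Squarefree q) {x y : ℕ} (hx : x < q)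
    (hy : y < q) (h : ∀ p ∈ q.primeFactors, (x : ZMod p) = (y : ZMod p)) : x = y := by
  have hdvd : (q : ℤ) ∣ (y : ℤ) - x := hq.intCast_dvd_of_forall_primeFactors fun p hp =>
    Nat.modEq_iff_dvd.1 ((ZMod.natCast_eq_natCast_iff x y p).1 (h p hp))
  exact Nat.ModEq.eq_of_lt_of_lt (Nat.modEq_iff_dvd.2 hdvd) hx hy

theorem eq_of_mul_sq_eq {q : ℕ} (hq : Squarefree q) {a : ℤ} (ha : Int.gcd a q = 1)
    {m m' n : ℕ} (hm : m < q) (hm' : m' < q)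
    (h : (m : ZMod q) * (n : ZMod q) ^ 2 = (a : ZMod q))
    (h' : (m' : ZMod q) * (n : ZMod q) ^ 2 = (a : ZMod q)) : m = m' := by
  refine eq_of_forall_primeFactors_natCast_eq hq hm hm' fun p hp => ?_
  have hprime := Nat.prime_of_mem_primeFactors hp
  have := Fact.mk hprime
  have hpq := Nat.dvd_of_mem_primeFactors hp
  have e := natCast_mul_sq_eq_of_dvd hpq h
  have e' := natCast_mul_sq_eq_of_dvd hpq h'
  have ha0 := intCast_ne_zero_of_gcd_eq_one hprime hpq ha
  have hn : (n : ZMod p) ^ 2 ≠ 0 := fun h0 => ha0 (by rw [← e, h0, mul_zero])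
  exact mul_right_cancel₀ hn (e.trans e'.symm)

theorem card_le_two_pow_of_mul_sq_eq {q : ℕ} (hq : Squarefree q) {a : ℤ} (ha : Int.gcd a q = 1)
    (m : ℕ) (S : Finset ℕ) (hS : ∀ n ∈ S, n < q)
    (h : ∀ n ∈ S, (m : ZMod q) * (n : ZMod q) ^ 2 = (a : ZMod q)) :
    S.card ≤ 2 ^ q.primeFactors.card := by
  have key := Finset.card_le_prod_of_injOn S
    (fun (p : q.primeFactors) (n : ℕ) => (n : ZMod p)) (fun _ => 2) ?_ ?_
  · simpa using key
  · intro x hx y hy hxy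
    exact eq_of_forall_primeFactors_natCast_eq hq (hS x hx) (hS y hy) fun p hp => hxy ⟨p, hp⟩
  · intro p
    have hprime := Nat.prime_of_mem_primeFactors p.2
    have := Fact.mk hprime
    have hpq := Nat.dvd_of_mem_primeFactors p.2
    have ha0 := intCast_ne_zero_of_gcd_eq_one hprime hpq ha
    rcases S.eq_empty_or_nonempty with rfl | ⟨n₀, hn₀⟩
    · simp
    have e₀ := natCast_mul_sq_eq_of_dvd hpq (h n₀ hn₀)
    refine (Finset.card_le_card (t := {(n₀ : ZMod p), -(n₀ : ZMod p)}) ?_).trans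
      Finset.card_le_two
    intro z hz
    obtain ⟨n, hn, rfl⟩ := Finset.mem_image.1 hz
    have e := natCast_mul_sq_eq_of_dvd hpq (h n hn)
    have hm : (m : ZMod p) ≠ 0 := fun h0 => ha0 (by rw [← e, h0, zero_mul])
    have := mul_left_cancel₀ hm (e.trans e₀.symm)
    simpa using sq_eq_sq_iff_eq_or_eq_neg.1 this

theorem exists_card_solutions_le : ∃ C : ℝ, 0 < C ∧ ∀ (q : ℕ) (a : ℤ) (x y : ℝ)
    (S : Finset (ℕ × ℕ)), Squarefree q → Int.gcd a q = 1 → 1 ≤ x → 1 ≤ y →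
    x ^ 48 ≤ q → y ^ 48 ≤ q → 2 * x ^ 36 < q → 2 * y ^ 36 < q →
    (∀ z ∈ S, 1 ≤ z.1 ∧ (z.1 : ℝ) ≤ 2 * x ^ 36) → (∀ z ∈ S, 1 ≤ z.2 ∧ (z.2 : ℝ) ≤ 2 * y ^ 36) →
    (∀ z ∈ S, (z.1 : ZMod q) * (z.2 : ZMod q) ^ 2 = (a : ZMod q)) →
    (S.card : ℝ) ≤ C * 104 ^ q.primeFactors.card * (x ^ 11 * y ^ 22) := by
  obtain ⟨C, hC, hmain⟩ := exists_card_le_of_determinesSlopes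
  refine ⟨2 * C + 2, by positivity, ?_⟩
  intro q a x y S hq ha hx hy hxq hyq hxq' hyq' h1 h2 h
  have hx0 : 0 < x := by linarith
  have hy0 : 0 < y := by linarith
  have hlt1 : ∀ z ∈ S, z.1 < q := fun z hz => by exact_mod_cast (h1 z hz).2.trans_lt hxq'
  have hlt2 : ∀ z ∈ S, z.2 < q := fun z hz => by exact_mod_cast (h2 z hz).2.trans_lt hyq'
  have hsnd : S.card ≤ (S.image Prod.snd).card := by
    rw [Finset.card_image_of_injOn]
    rintro ⟨m, n⟩ hz ⟨m', n'⟩ hz' rfl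
    exact Prod.ext (eq_of_mul_sq_eq hq ha (hlt1 _ hz) (hlt1 _ hz') (h _ hz) (h _ hz')) rfl
  have hpow : (52 : ℝ) ^ q.primeFactors.card ≤ 104 ^ q.primeFactors.card := by
    gcongr; norm_num
  have hpow1 : (1 : ℝ) ≤ 104 ^ q.primeFactors.card := one_le_pow₀ (by norm_num)
  rcases le_total x y with hxy | hxy
  · have hex : ∀ m ∈ S.image Prod.fst, ∃ n, (m, n) ∈ S := by
      intro m hm
      obtain ⟨⟨m, n⟩, hz, rfl⟩ := Finset.mem_image.1 hm
      exact ⟨n, hz⟩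
    choose! β hβ using hex
    have hA := hmain q (x ^ 12) (y ^ 9) (S.image Prod.fst) β hq (one_le_pow₀ hx)
      (by rw [← pow_mul]; exact hxq) (one_le_pow₀ hy)
      (fun m hm => by rw [← pow_mul]; exact h1 _ (hβ m hm))
      (fun m hm => by rw [← pow_mul]; exact h2 _ (hβ m hm))
      (determinesSlopes_of_mul_sq_eq ha fun m hm => h _ (hβ m hm))
    have hfib : S.card ≤ 2 ^ q.primeFactors.card * (S.image Prod.fst).card := by
      refine Finset.card_le_mul_card_image S _ fun m _ => ?_
      calc _ = ((S.filter fun z => z.1 = m).image Prod.snd).card := by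
            rw [Finset.card_image_of_injOn]
            rintro ⟨m₁, n₁⟩ hz ⟨m₂, n₂⟩ hz' hn
            have e₁ := (Finset.mem_filter.1 hz).2
            have e₂ := (Finset.mem_filter.1 hz').2
            exact Prod.ext (e₁.trans e₂.symm) hn
        _ ≤ _ := by
            refine card_le_two_pow_of_mul_sq_eq hq ha m _ ?_ ?_ <;>
            · intro n hn
              obtain ⟨⟨m', n'⟩, hz, rfl⟩ := Finset.mem_image.1 hn
              obtain ⟨hzS, rfl⟩ := Finset.mem_filter.1 hz
              first | exact hlt2 _ hzS | exact h _ hzS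
    have b1 : x ^ 12 * (y ^ 9) ^ 2 ≤ x ^ 11 * y ^ 22 := by
      calc x ^ 12 * (y ^ 9) ^ 2 = x ^ 11 * (x * y ^ 18) := by ring
        _ ≤ x ^ 11 * (y ^ 4 * y ^ 18) := by
            gcongr; exact hxy.trans (le_self_pow₀ hy (by norm_num))
        _ = _ := by ring
    have b2 : (x ^ 12) ^ 2 * y ^ 9 ≤ x ^ 11 * y ^ 22 := by
      calc (x ^ 12) ^ 2 * y ^ 9 = x ^ 11 * (x ^ 13 * y ^ 9) := by ring
        _ ≤ x ^ 11 * (y ^ 13 * y ^ 9) := by gcongr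
        _ = _ := by ring
    calc (S.card : ℝ) ≤ 2 ^ q.primeFactors.card * (S.image Prod.fst).card := by
          exact_mod_cast hfib
      _ ≤ 2 ^ q.primeFactors.card * (C * 52 ^ q.primeFactors.card *
            (x ^ 11 * y ^ 22 + x ^ 11 * y ^ 22)) := by
          gcongr
          exact hA.trans (by gcongr)
      _ = 2 * C * (2 * 52) ^ q.primeFactors.card * (x ^ 11 * y ^ 22) := by
          rw [mul_pow]; ring
      _ ≤ (2 * C + 2) * 104 ^ q.primeFactors.card * (x ^ 11 * y ^ 22) := by
          gcongr <;> norm_num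
  rcases le_total (x ^ 7) (y ^ 10) with hxy' | hxy'
  · have hex : ∀ n ∈ S.image Prod.snd, ∃ m, (m, n) ∈ S := by
      intro n hn
      obtain ⟨⟨m, n⟩, hz, rfl⟩ := Finset.mem_image.1 hn
      exact ⟨m, hz⟩
    choose! β hβ using hex
    have hA := hmain q (y ^ 12) (x ^ 9) (S.image Prod.snd) β hq (one_le_pow₀ hy)
      (by rw [← pow_mul]; exact hyq) (one_le_pow₀ hx)
      (fun n hn => by rw [← pow_mul]; exact h2 _ (hβ n hn))
      (fun n hn => by rw [← pow_mul]; exact h1 _ (hβ n hn))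
      (determinesSlopes_of_sq_mul_eq ha fun n hn => h _ (hβ n hn))
    have b1 : y ^ 12 * (x ^ 9) ^ 2 ≤ x ^ 11 * y ^ 22 := by
      calc y ^ 12 * (x ^ 9) ^ 2 = x ^ 11 * (y ^ 12 * x ^ 7) := by ring
        _ ≤ x ^ 11 * (y ^ 12 * y ^ 10) := by gcongr
        _ = _ := by ring
    have b2 : (y ^ 12) ^ 2 * x ^ 9 ≤ x ^ 11 * y ^ 22 := by
      calc (y ^ 12) ^ 2 * x ^ 9 = y ^ 22 * x ^ 9 * y ^ 2 := by ring
        _ ≤ y ^ 22 * x ^ 9 * x ^ 2 := by gcongr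
        _ = _ := by ring
    calc (S.card : ℝ) ≤ (S.image Prod.snd).card := by exact_mod_cast hsnd
      _ ≤ C * 52 ^ q.primeFactors.card * (x ^ 11 * y ^ 22 + x ^ 11 * y ^ 22) :=
          hA.trans (by gcongr)
      _ = 2 * C * 52 ^ q.primeFactors.card * (x ^ 11 * y ^ 22) := by ring
      _ ≤ (2 * C + 2) * 104 ^ q.primeFactors.card * (x ^ 11 * y ^ 22) := by
          gcongr; norm_num
  · have hcard : (S.image Prod.snd).card ≤ ⌊2 * y ^ 36⌋₊ := by
      calc _ ≤ (Icc 1 ⌊2 * y ^ 36⌋₊).card := by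
            refine Finset.card_le_card fun n hn => ?_
            obtain ⟨z, hz, rfl⟩ := Finset.mem_image.1 hn
            exact Finset.mem_Icc.2 ⟨(h2 z hz).1, Nat.le_floor (h2 z hz).2⟩
        _ = _ := by simp
    calc (S.card : ℝ) ≤ (⌊2 * y ^ 36⌋₊ : ℝ) := by exact_mod_cast hsnd.trans hcard
      _ ≤ 2 * y ^ 36 := Nat.floor_le (by positivity)
      _ = 2 * 1 * ((y ^ 10 * y ^ 4) * y ^ 22) := by ring
      _ ≤ (2 * C + 2) * 104 ^ q.primeFactors.card * ((x ^ 7 * x ^ 4) * y ^ 22) := by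
          gcongr
          linarith
      _ = _ := by ring

/-- Key estimate of Section 4: for every ε > 0 there is C = C(ε) such that for q
squarefree, a coprime to q, and 1 ≤ M, N ≤ q^(3/4) with M, N < q/2, the number of pairs
(m,n) of positive integers with M < m ≤ 2M, N < n ≤ 2N and m·n² ≡ a (mod q) is at most
C · q^ε · (M·N²)^(11/36). -/
theorem dyadic_box_eleven_thirtysixths :
    ∀ ε : ℝ, 0 < ε → ∃ C : ℝ, 0 < C ∧
      ∀ q : ℕ, Squarefree q → ∀ a : ℤ, Int.gcd a q = 1 → ∀ M N : ℝ,
        1 ≤ M → M ≤ (q : ℝ) ^ ((3 : ℝ) / 4) → 1 ≤ N → N ≤ (q : ℝ) ^ ((3 : ℝ) / 4) →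
        M < (q : ℝ) / 2 → N < (q : ℝ) / 2 →
          ((((Finset.Ioc ⌊M⌋₊ ⌊2 * M⌋₊) ×ˢ (Finset.Ioc ⌊N⌋₊ ⌊2 * N⌋₊)).filter
              (fun p : ℕ × ℕ =>
                (p.1 : ZMod q) * (p.2 : ZMod q) ^ 2 = (a : ZMod q))).card : ℝ)
            ≤ C * (q : ℝ) ^ ε * (M * N ^ 2) ^ ((11 : ℝ) / 36) := by
  intro ε hε
  obtain ⟨C₁, hC₁, hmain⟩ := exists_card_solutions_le
  obtain ⟨C₂, hC₂, hω⟩ := exists_pow_card_primeFactors_le 104 ε (by norm_num) hε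
  refine ⟨C₁ * C₂, by positivity, ?_⟩
  intro q hq a ha M N hM hMq hN hNq hMq' hNq'
  have hroot : ∀ t : ℝ, 1 ≤ t → t ≤ (q : ℝ) ^ ((3 : ℝ) / 4) →
      ∃ x : ℝ, 1 ≤ x ∧ x ^ 36 = t ∧ x ^ 48 ≤ q := by
    intro t ht htq
    have ht0 : 0 ≤ t := by linarith
    refine ⟨t ^ (1 / 36 : ℝ), Real.one_le_rpow ht (by norm_num), ?_, ?_⟩
    · rw [← Real.rpow_natCast, ← Real.rpow_mul ht0]; norm_num
    · calc (t ^ (1 / 36 : ℝ)) ^ 48 = t ^ (4 / 3 : ℝ) := by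
            rw [← Real.rpow_natCast, ← Real.rpow_mul ht0]; norm_num
        _ ≤ ((q : ℝ) ^ ((3 : ℝ) / 4)) ^ (4 / 3 : ℝ) :=
            Real.rpow_le_rpow ht0 htq (by norm_num)
        _ = q := by rw [← Real.rpow_mul (Nat.cast_nonneg q)]; norm_num
  obtain ⟨x, hx, rfl, hxq⟩ := hroot M hM hMq
  obtain ⟨y, hy, rfl, hyq⟩ := hroot N hN hNq
  have hT : (x ^ 36 * (y ^ 36) ^ 2) ^ ((11 : ℝ) / 36) = x ^ 11 * y ^ 22 := by
    have hxy : 0 ≤ x * y ^ 2 := by positivity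
    calc (x ^ 36 * (y ^ 36) ^ 2) ^ ((11 : ℝ) / 36)
        = ((x * y ^ 2) ^ 36) ^ ((11 : ℝ) / 36) := by congr 1; ring
      _ = (x * y ^ 2) ^ 11 := by
          rw [← Real.rpow_natCast _ 36, ← Real.rpow_mul hxy, ← Real.rpow_natCast _ 11]
          norm_num
      _ = _ := by ring
  rw [hT]
  have hbox : ∀ (t : ℝ) (k : ℕ), 0 ≤ t → k ∈ Finset.Ioc ⌊t⌋₊ ⌊2 * t⌋₊ →
      1 ≤ k ∧ (k : ℝ) ≤ 2 * t := by
    intro t k ht hk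
    have hk := Finset.mem_Ioc.1 hk
    exact ⟨by omega, (Nat.cast_le.2 hk.2).trans (Nat.floor_le (by positivity))⟩
  refine (hmain q a x y _ hq ha hx hy hxq hyq (by linarith) (by linarith) ?_ ?_ ?_).trans ?_
  · exact fun z hz => hbox _ _ (by positivity) (Finset.mem_product.1 (Finset.mem_filter.1 hz).1).1
  · exact fun z hz => hbox _ _ (by positivity) (Finset.mem_product.1 (Finset.mem_filter.1 hz).1).2
  · exact fun z hz => (Finset.mem_filter.1 hz).2
  · rw [mul_assoc C₁ C₂]
    gcongr
    exact hω q hq
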